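/- Let E be a uniformly convex Banach space satisfying Opial's condition, C ⊆ E nonempty closed convex, T : C → C nonexpansive with F(T) ≠ ∅, and let x_n be the iteration x_{n+1} = T y_n, y_n = (1-α_n) z_n + α_n T z_n, z_n = (1-β_n) x_n + β_n T x_n with α_n, β_n bounded away from 0 and 1. Then x_n converges weakly to a fixed point of T. -/

import Mathlib

open Filter

theorem uc_scaled {E : Type*} [NormedAddCommGroup E] [NormedSpace ℝ E]
    [UniformConvexSpace E] (r : ℝ) (hr : 0 ≤ r) (ε : ℝ) (hε : 0 < ε) :
    ∃ δ > 0, ∀ x y : E, ‖x‖ ≤ r + δ → ‖y‖ ≤ r + δ → 2 * r - δ ≤ ‖x + y‖ → ‖x - y‖ < ε := by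
  obtain ⟨δ₀, hδ₀, h⟩ := exists_forall_closed_ball_dist_add_le_two_mul_sub E (half_pos hε) r
  have key : ∀ δ > 0, ∀ x : E, ‖x‖ ≤ r + δ → ∃ x' : E, ‖x'‖ ≤ r ∧ ‖x - x'‖ ≤ δ := by
    intro δ hδ x hx
    have hp : 0 < r + δ := by linarith
    refine ⟨(r / (r + δ)) • x, ?_, ?_⟩
    · rw [norm_smul, Real.norm_of_nonneg (by positivity), div_mul_eq_mul_div, div_le_iff₀ hp]
      exact mul_le_mul_of_nonneg_left hx hr
    · have : x - (r / (r + δ)) • x = (δ / (r + δ)) • x := by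
        have h1 : δ / (r + δ) = 1 - r / (r + δ) := by field_simp; ring
        rw [h1, sub_smul, one_smul]
      rw [this, norm_smul, Real.norm_of_nonneg (by positivity), div_mul_eq_mul_div, div_le_iff₀ hp]
      exact mul_le_mul_of_nonneg_left hx hδ.le
  refine ⟨min (δ₀ / 4) (ε / 8), by positivity, ?_⟩
  set δ := min (δ₀ / 4) (ε / 8) with hδdef
  have hδ : 0 < δ := by positivity
  have h1 : δ ≤ δ₀ / 4 := min_le_left _ _
  have h2 : δ ≤ ε / 8 := min_le_right _ _
  intro x y hx hy hxy
  by_contra! hcon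
  obtain ⟨x', hx', hxx⟩ := key δ hδ x hx
  obtain ⟨y', hy', hyy⟩ := key δ hδ y hy
  have e1 : ‖x - y‖ ≤ ‖x' - y'‖ + (‖x - x'‖ + ‖y - y'‖) := by
    have : x - y = (x' - y') + ((x - x') - (y - y')) := by abel
    rw [this]
    exact (norm_add_le _ _).trans (add_le_add le_rfl (norm_sub_le _ _))
  have e2 : ‖x + y‖ ≤ ‖x' + y'‖ + (‖x - x'‖ + ‖y - y'‖) := by
    have : x + y = (x' + y') + ((x - x') + (y - y')) := by abel
    rw [this]
    exact (norm_add_le _ _).trans (add_le_add le_rfl (norm_add_le _ _))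
  have := h hx' hy' (by linarith)
  linarith

theorem nested_nonempty {E : Type*} [NormedAddCommGroup E] [NormedSpace ℝ E]
    [UniformConvexSpace E] [CompleteSpace E] (K : ℕ → Set E) (hK : Antitone K)
    (hne : ∀ n, (K n).Nonempty) (hcl : ∀ n, IsClosed (K n)) (hcv : ∀ n, Convex ℝ (K n))
    (M : ℝ) (hM : ∀ x ∈ K 0, ‖x‖ ≤ M) : ∃ w, ∀ n, w ∈ K n := by
  set d : ℕ → ℝ := fun n => Metric.infDist 0 (K n) with hd
  have hle : ∀ n, ∀ x ∈ K n, d n ≤ ‖x‖ := fun n x hx => by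
    have := Metric.infDist_le_dist_of_mem (x := (0 : E)) hx
    rwa [dist_zero_left] at this
  have hmono : Monotone d := fun m n hmn =>
    Metric.infDist_le_infDist_of_subset (hK hmn) (hne n)
  have hbdd : BddAbove (Set.range d) := by
    refine ⟨M, ?_⟩
    rintro _ ⟨n, rfl⟩
    obtain ⟨x, hx⟩ := hne n
    exact (hle n x hx).trans (hM x (hK (Nat.zero_le n) hx))
  set D := ⨆ n, d n with hD
  have hlim : Tendsto d atTop (nhds D) := tendsto_atTop_ciSup hmono hbdd
  have hdD : ∀ n, d n ≤ D := fun n => le_ciSup hbdd n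
  have hD0 : 0 ≤ D := Metric.infDist_nonneg.trans (hdD 0)
  have hw : ∀ n : ℕ, ∃ w ∈ K n, ‖w‖ < d n + 1 / ((n : ℝ) + 1) := by
    intro n
    obtain ⟨w, hw, h⟩ := (Metric.infDist_lt_iff (x := (0 : E)) (hne n)).1
      (show Metric.infDist 0 (K n) < d n + 1 / ((n : ℝ) + 1) by
        have : 0 < 1 / ((n : ℝ) + 1) := by positivity
        simp only [hd]; linarith)
    rw [dist_zero_left] at h
    exact ⟨w, hw, h⟩
  choose w hwK hwn using hw
  have hcau : CauchySeq w := by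
    rw [Metric.cauchySeq_iff]
    intro ε hε
    obtain ⟨δ, hδ, h⟩ := uc_scaled (E := E) D hD0 ε hε
    have e1 : ∀ᶠ n in atTop, D - δ / 2 < d n := hlim.eventually (lt_mem_nhds (by linarith))
    have e2 : ∀ᶠ n : ℕ in atTop, 1 / ((n : ℝ) + 1) < δ :=
      tendsto_one_div_add_atTop_nhds_zero_nat.eventually (gt_mem_nhds hδ)
    obtain ⟨N, hN⟩ := eventually_atTop.1 (e1.and e2)
    refine ⟨N, fun m hm n hn => ?_⟩
    rw [dist_eq_norm]
    apply h
    · linarith [hwn m, hdD m, (hN m hm).2]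
    · linarith [hwn n, hdD n, (hN n hn).2]
    · have hmid : (1 / 2 : ℝ) • w m + (1 / 2 : ℝ) • w n ∈ K N :=
        hcv N (hK hm (hwK m)) (hK hn (hwK n)) (by norm_num) (by norm_num) (by norm_num)
      have := hle N _ hmid
      rw [← smul_add, norm_smul, Real.norm_of_nonneg (by norm_num)] at this
      linarith [(hN N le_rfl).1]
  obtain ⟨v, hv⟩ := cauchySeq_tendsto_of_complete hcau
  exact ⟨v, fun n => (hcl n).mem_of_tendsto hv
    (eventually_atTop.2 ⟨n, fun m hm => hK hm (hwK m)⟩)⟩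

theorem cluster_exists {E : Type*} [NormedAddCommGroup E] [NormedSpace ℝ E]
    [UniformConvexSpace E] [CompleteSpace E] (u : ℕ → E) (M : ℝ) (hM : ∀ n, ‖u n‖ ≤ M) :
    ∃ w, ∀ H : Set E, IsClosed H → Convex ℝ H → (∀ᶠ k in atTop, u k ∈ H) → w ∈ H := by
  obtain ⟨w, hw⟩ := nested_nonempty (fun n => closure (convexHull ℝ (u '' Set.Ici n)))
    (fun m n hmn => closure_mono (convexHull_mono (Set.image_mono (Set.Ici_subset_Ici.2 hmn))))
    (fun n => ⟨u n, subset_closure (subset_convexHull ℝ _ ⟨n, Set.self_mem_Ici, rfl⟩)⟩)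
    (fun n => isClosed_closure) (fun n => (convex_convexHull ℝ _).closure) M
    (by
      have : closure (convexHull ℝ (u '' Set.Ici 0)) ⊆ Metric.closedBall 0 M := by
        refine closure_minimal (convexHull_min ?_ (convex_closedBall _ _)) Metric.isClosed_closedBall
        rintro _ ⟨n, -, rfl⟩
        simpa using hM n
      intro x hx
      simpa using this hx)
  refine ⟨w, fun H hH hc he => ?_⟩
  obtain ⟨N, hN⟩ := eventually_atTop.1 he
  refine closure_minimal (convexHull_min ?_ hc) hH (hw N)
  rintro _ ⟨n, hn, rfl⟩
  exact hN n hn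

theorem cluster_lim {E : Type*} [NormedAddCommGroup E] [NormedSpace ℝ E]
    (u : ℕ → E) (w : E)
    (hw : ∀ H : Set E, IsClosed H → Convex ℝ H → (∀ᶠ k in atTop, u k ∈ H) → w ∈ H)
    (f : E →L[ℝ] ℝ) (l : ℝ) (hl : Tendsto (fun n => f (u n)) atTop (nhds l)) : f w = l := by
  refine eq_of_forall_dist_le fun ε hε => ?_
  have := hw (f ⁻¹' Metric.closedBall l ε) (Metric.isClosed_closedBall.preimage f.continuous)
    ((convex_closedBall l ε).linear_preimage f.toLinearMap)
    (hl.eventually (Metric.closedBall_mem_nhds l hε))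
  exact this

/-- failure of convergence gives a subsequence staying on one side -/
theorem bad_subseq (g : ℕ → ℝ) (l : ℝ) (h : ¬ Tendsto g atTop (nhds l)) :
    ∃ ε > 0, ∃ φ : ℕ → ℕ, StrictMono φ ∧
      ((∀ k, l + ε ≤ g (φ k)) ∨ (∀ k, g (φ k) ≤ l - ε)) := by
  rw [Metric.tendsto_nhds] at h
  push Not at h
  obtain ⟨ε, hε, h⟩ := h
  have h' : ∃ᶠ n in atTop, (l + ε ≤ g n ∨ g n ≤ l - ε) := by
    refine h.mono fun n hn => ?_
    rw [Real.dist_eq, le_abs] at hn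
    rcases hn with hn | hn
    · left; linarith
    · right; linarith
  rcases frequently_or_distrib.1 h' with h1 | h1
  · obtain ⟨φ, hφ, h2⟩ := extraction_of_frequently_atTop h1
    exact ⟨ε, hε, φ, hφ, Or.inl h2⟩
  · obtain ⟨φ, hφ, h2⟩ := extraction_of_frequently_atTop h1
    exact ⟨ε, hε, φ, hφ, Or.inr h2⟩

theorem weak_seq_compact {E : Type*} [NormedAddCommGroup E] [NormedSpace ℝ E]
    [UniformConvexSpace E] [CompleteSpace E] (u : ℕ → E) (M : ℝ) (hM : ∀ n, ‖u n‖ ≤ M) :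
    ∃ w, ∃ φ : ℕ → ℕ, StrictMono φ ∧
      (∀ H : Set E, IsClosed H → Convex ℝ H → (∀ k, u k ∈ H) → w ∈ H) ∧
      ∀ f : E →L[ℝ] ℝ, Tendsto (fun n => f (u (φ n))) atTop (nhds (f w)) := by
  set S : Submodule ℝ E := (Submodule.span ℝ (Set.range u)).topologicalClosure with hS
  have huS : ∀ n, u n ∈ S := fun n =>
    Submodule.le_topologicalClosure _ (Submodule.subset_span ⟨n, rfl⟩)
  have hScl : IsClosed (S : Set E) := Submodule.isClosed_topologicalClosure _
  have hsep : TopologicalSpace.IsSeparable (S : Set E) := by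
    have := ((Set.countable_range u).isSeparable.span (R := ℝ)).closure
    rwa [hS, Submodule.topologicalClosure_coe]
  obtain ⟨c, hc, hSc⟩ := hsep
  have : Countable c := hc.to_subtype
  have hdual : ∀ d : c, ∃ g : E →L[ℝ] ℝ, ‖g‖ ≤ 1 ∧ g d = ‖(d : E)‖ := fun d => by
    obtain ⟨g, h1, h2⟩ := exists_dual_vector'' ℝ (d : E)
    exact ⟨g, h1, by simpa using h2⟩
  choose g hg1 hg2 using hdual
  have hsepar : ∀ s ∈ S, (∀ d, g d s = 0) → s = 0 := by
    intro s hs h0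
    have hs' := hSc hs
    rw [Metric.mem_closure_iff] at hs'
    rw [← norm_le_zero_iff]
    refine le_of_forall_pos_le_add fun ε hε => ?_
    obtain ⟨d, hd, hsd⟩ := hs' (ε / 2) (by positivity)
    rw [dist_eq_norm] at hsd
    have e1 : ‖d‖ ≤ ‖s - d‖ := by
      have h1 : g ⟨d, hd⟩ (d - s) = ‖d‖ := by
        rw [map_sub, h0, sub_zero, hg2]
      calc ‖d‖ = g ⟨d, hd⟩ (d - s) := h1.symm
        _ ≤ ‖g ⟨d, hd⟩ (d - s)‖ := le_abs_self _
        _ ≤ 1 * ‖d - s‖ := (g ⟨d, hd⟩).le_of_opNorm_le (hg1 _) _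
        _ = ‖s - d‖ := by rw [one_mul, norm_sub_rev]
    have e2 : ‖s‖ ≤ ‖s - d‖ + ‖d‖ := by simpa using norm_add_le (s - d) d
    linarith
  have hcomp : IsCompact (Set.pi Set.univ fun _ : c => Metric.closedBall (0 : ℝ) M) :=
    isCompact_univ_pi fun _ => isCompact_closedBall _ _
  obtain ⟨l, -, φ, hφ, hl⟩ := hcomp.tendsto_subseq (x := fun n d => g d (u n)) (by
    intro n d _
    rw [mem_closedBall_zero_iff]
    calc ‖g d (u n)‖ ≤ 1 * ‖u n‖ := (g d).le_of_opNorm_le (hg1 _) _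
      _ ≤ M := by rw [one_mul]; exact hM n)
  rw [tendsto_pi_nhds] at hl
  obtain ⟨w, hw⟩ := cluster_exists (fun n => u (φ n)) M (fun n => hM _)
  have hwS : w ∈ S := hw S hScl S.convex (Eventually.of_forall fun k => huS _)
  have hwl : ∀ d, g d w = l d := fun d => cluster_lim _ w hw (g d) _ (hl d)
  refine ⟨w, φ, hφ, fun H h1 h2 h3 => hw H h1 h2 (Eventually.of_forall fun k => h3 _), ?_⟩
  intro f
  by_contra hcon
  obtain ⟨ε, hε, ψ, hψ, hbad⟩ := bad_subseq _ _ hcon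
  obtain ⟨w', hw'⟩ := cluster_exists (fun n => u (φ (ψ n))) M (fun n => hM _)
  have hwS' : w' ∈ S := hw' S hScl S.convex (Eventually.of_forall fun k => huS _)
  have hwl' : ∀ d, g d w' = l d := fun d =>
    cluster_lim _ w' hw' (g d) _ ((hl d).comp hψ.tendsto_atTop)
  have heq : w' = w := by
    rw [← sub_eq_zero]
    refine hsepar _ (S.sub_mem hwS' hwS) fun d => ?_
    rw [map_sub, hwl, hwl', sub_self]
  rw [heq] at hw'
  rcases hbad with hbad | hbad
  · have := hw' (f ⁻¹' Set.Ici (f w + ε)) (isClosed_Ici.preimage f.continuous)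
      ((convex_Ici _).linear_preimage f.toLinearMap) (Eventually.of_forall hbad)
    simp only [Set.mem_preimage, Set.mem_Ici] at this
    linarith
  · have := hw' (f ⁻¹' Set.Iic (f w - ε)) (isClosed_Iic.preimage f.continuous)
      ((convex_Iic _).linear_preimage f.toLinearMap) (Eventually.of_forall hbad)
    simp only [Set.mem_preimage, Set.mem_Iic] at this
    linarith

theorem mann_bound {E : Type*} [NormedAddCommGroup E] [NormedSpace ℝ E]
    (X Y : E) (r t κ : ℝ) (hκ : 0 ≤ κ) (hX : ‖X‖ ≤ r) (hY : ‖Y‖ ≤ r) (h1 : κ ≤ t) (h2 : κ ≤ 1 - t) :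
    ‖(1 - t) • X + t • Y‖ + κ * (2 * r - ‖X + Y‖) ≤ r := by
  have hXY : ‖X + Y‖ ≤ 2 * r := (norm_add_le _ _).trans (by linarith)
  have aux : ∀ (X Y : E) (s : ℝ), ‖X‖ ≤ r → κ ≤ s → s ≤ 1 / 2 → 0 ≤ s → ‖X + Y‖ ≤ 2 * r →
      ‖(1 - s) • X + s • Y‖ + κ * (2 * r - ‖X + Y‖) ≤ r := by
    intro X Y s hX hs hs2 hs0 hXY
    have e : (1 - s) • X + s • Y = (1 - 2 * s) • X + s • (X + Y) := by module
    have e1 : ‖(1 - s) • X + s • Y‖ ≤ (1 - 2 * s) * ‖X‖ + s * ‖X + Y‖ := by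
      rw [e]
      refine (norm_add_le _ _).trans ?_
      rw [norm_smul, norm_smul, Real.norm_of_nonneg hs0, Real.norm_of_nonneg (by linarith)]
    nlinarith [mul_nonneg (sub_nonneg.2 hs) (sub_nonneg.2 hXY),
      mul_nonneg (show 0 ≤ 1 - 2 * s by linarith) (sub_nonneg.2 hX)]
  rcases le_total t (1 / 2) with ht | ht
  · exact aux X Y t hX h1 ht (hκ.trans h1) hXY
  · have := aux Y X (1 - t) hY h2 (by linarith) (hκ.trans h2) (by rwa [add_comm])
    rw [sub_sub_cancel, add_comm (t • Y), add_comm Y X] at this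
    exact this

theorem weak_convergence_opial
    {E : Type*} [NormedAddCommGroup E] [NormedSpace ℝ E]
    [UniformConvexSpace E] [CompleteSpace E]
    (hOpial : ∀ (u : ℕ → E) (w : E),
      (∀ f : E →L[ℝ] ℝ, Tendsto (fun n => f (u n)) atTop (nhds (f w))) →
      ∀ v : E, v ≠ w →
        Filter.limsup (fun n => ‖u n - w‖) atTop <
          Filter.limsup (fun n => ‖u n - v‖) atTop)
    (C : Set E) (hCne : C.Nonempty) (hCcl : IsClosed C) (hCcv : Convex ℝ C)
    (T : E → E) (hTmaps : Set.MapsTo T C C)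
    (hT : ∀ x ∈ C, ∀ y ∈ C, ‖T x - T y‖ ≤ ‖x - y‖)
    (hF : ∃ p ∈ C, T p = p)
    (a b : ℝ) (ha : 0 < a) (hb : b < 1)
    (α β : ℕ → ℝ)
    (hα : ∀ n, a ≤ α n ∧ α n ≤ b) (hβ : ∀ n, a ≤ β n ∧ β n ≤ b)
    (x y z : ℕ → E) (hx0 : x 0 ∈ C)
    (hz : ∀ n, z n = (1 - β n) • x n + β n • T (x n))
    (hy : ∀ n, y n = (1 - α n) • z n + α n • T (z n))
    (hx : ∀ n, x (n + 1) = T (y n)) :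
    ∃ q ∈ C, T q = q ∧
      ∀ f : E →L[ℝ] ℝ, Tendsto (fun n => f (x n)) atTop (nhds (f q)) := by
  have ha1 : ∀ n, 0 ≤ α n ∧ 0 ≤ 1 - α n := fun n =>
    ⟨by linarith [(hα n).1], by linarith [(hα n).2]⟩
  have hb1 : ∀ n, 0 ≤ β n ∧ 0 ≤ 1 - β n := fun n =>
    ⟨by linarith [(hβ n).1], by linarith [(hβ n).2]⟩
  have hzC' : ∀ n, x n ∈ C → z n ∈ C := fun n h => by
    rw [hz]; exact hCcv h (hTmaps h) (hb1 n).2 (hb1 n).1 (by ring)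
  have hyC' : ∀ n, z n ∈ C → y n ∈ C := fun n h => by
    rw [hy]; exact hCcv h (hTmaps h) (ha1 n).2 (ha1 n).1 (by ring)
  have hxC : ∀ n, x n ∈ C := by
    intro n
    induction n with
    | zero => exact hx0
    | succ k ih => rw [hx]; exact hTmaps (hyC' k (hzC' k ih))
  have hzC := fun n => hzC' n (hxC n)
  have hyC := fun n => hyC' n (hzC n)
  have hTp : ∀ p ∈ C, T p = p → ∀ v ∈ C, ‖T v - p‖ ≤ ‖v - p‖ := fun p hp hpp v hv => by
    have := hT v hv p hp
    rwa [hpp] at this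
  have hconv : ∀ p ∈ C, T p = p → ∀ v ∈ C, ∀ t : ℝ, 0 ≤ t → 0 ≤ 1 - t →
      ‖(1 - t) • v + t • T v - p‖ ≤ ‖v - p‖ := by
    intro p hp hpp v hv t h0 h1
    have e : (1 - t) • v + t • T v - p = (1 - t) • (v - p) + t • (T v - p) := by module
    rw [e]
    refine (norm_add_le _ _).trans ?_
    rw [norm_smul, norm_smul, Real.norm_of_nonneg h0, Real.norm_of_nonneg h1]
    nlinarith [mul_le_mul_of_nonneg_left (hTp p hp hpp v hv) h0]
  have hzx : ∀ p ∈ C, T p = p → ∀ n, ‖z n - p‖ ≤ ‖x n - p‖ := fun p hp hpp n => by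
    rw [hz]; exact hconv p hp hpp _ (hxC n) _ (hb1 n).1 (hb1 n).2
  have hxz : ∀ p ∈ C, T p = p → ∀ n, ‖x (n + 1) - p‖ ≤ ‖z n - p‖ := fun p hp hpp n => by
    rw [hx]
    refine (hTp p hp hpp _ (hyC n)).trans ?_
    rw [hy]; exact hconv p hp hpp _ (hzC n) _ (ha1 n).1 (ha1 n).2
  have hanti : ∀ p ∈ C, T p = p → Antitone fun n => ‖x n - p‖ := fun p hp hpp =>
    antitone_nat_of_succ_le fun n => (hxz p hp hpp n).trans (hzx p hp hpp n)
  have hbb : ∀ p : E, BddBelow (Set.range fun n => ‖x n - p‖) := fun p =>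
    ⟨0, by rintro _ ⟨n, rfl⟩; exact norm_nonneg _⟩
  have hlim : ∀ p ∈ C, T p = p → ∃ c, Tendsto (fun n => ‖x n - p‖) atTop (nhds c) ∧
      ∀ n, c ≤ ‖x n - p‖ := fun p hp hpp =>
    ⟨_, tendsto_atTop_ciInf (hanti p hp hpp) (hbb p), fun n => ciInf_le (hbb p) n⟩
  obtain ⟨p, hp, hpp⟩ := hF
  -- asymptotic regularity
  have hreg : Tendsto (fun n => ‖x n - T (x n)‖) atTop (nhds 0) := by
    obtain ⟨c, hc, hcle⟩ := hlim p hp hpp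
    have hc0 : 0 ≤ c := ge_of_tendsto' hc fun n => norm_nonneg _
    rw [Metric.tendsto_nhds]
    intro ε hε
    obtain ⟨δ, hδ, h⟩ := uc_scaled (E := E) c hc0 ε hε
    set κ := min a (1 - b) with hκd
    have hκ : 0 < κ := lt_min ha (by linarith)
    have hκa : κ ≤ a := min_le_left _ _
    have hκb : κ ≤ 1 - b := min_le_right _ _
    have e1 := hc.eventually (gt_mem_nhds (show c < c + δ by linarith))
    have e2 := hc.eventually (gt_mem_nhds (show c < c + κ * δ by linarith [mul_pos hκ hδ]))
    filter_upwards [e1, e2] with n h1 h2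
    rw [Real.dist_eq, sub_zero, abs_of_nonneg (norm_nonneg _)]
    have e : x n - T (x n) = (x n - p) - (T (x n) - p) := by abel
    have hTx := hTp p hp hpp _ (hxC n)
    rw [e]
    refine h _ _ h1.le (hTx.trans h1.le) ?_
    have hm := mann_bound (x n - p) (T (x n) - p) _ (β n) κ hκ.le le_rfl hTx
      (hκa.trans (hβ n).1) (by linarith [(hβ n).2])
    have ez : (1 - β n) • (x n - p) + β n • (T (x n) - p) = z n - p := by rw [hz]; module
    rw [ez] at hm
    have hcz := (hcle (n + 1)).trans (hxz p hp hpp n)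
    have h3 : κ * (2 * ‖x n - p‖ - ‖x n - p + (T (x n) - p)‖) < κ * δ := by linarith
    have h4 := lt_of_mul_lt_mul_left h3 hκ.le
    linarith [hcle n]
  have hbd : ∀ v : E, ∃ M, ∀ n, ‖x n - v‖ ≤ M := fun v => by
    refine ⟨‖x 0 - p‖ + ‖p - v‖, fun n => ?_⟩
    have h1 : ‖x n - p‖ ≤ ‖x 0 - p‖ := hanti p hp hpp (Nat.zero_le n)
    have h2 := norm_add_le (x n - p) (p - v)
    rw [sub_add_sub_cancel] at h2
    linarith
  -- demiclosedness
  have hdemi : ∀ φ : ℕ → ℕ, StrictMono φ → ∀ q ∈ C,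
      (∀ f : E →L[ℝ] ℝ, Tendsto (fun n => f (x (φ n))) atTop (nhds (f q))) → T q = q := by
    intro φ hφ q hq hw
    by_contra hne
    have hlt := hOpial (fun n => x (φ n)) q hw (T q) hne
    refine absurd hlt (not_lt.2 (le_of_forall_pos_le_add fun ε hε => ?_))
    obtain ⟨M, hM⟩ := hbd q
    have hB : IsBoundedUnder (· ≤ ·) atTop (fun n => ‖x (φ n) - q‖) :=
      isBoundedUnder_of ⟨M, fun n => hM _⟩
    have e1 : ∀ᶠ n in atTop, ‖x (φ n) - q‖ <
        limsup (fun n => ‖x (φ n) - q‖) atTop + ε / 2 :=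
      eventually_lt_of_limsup_lt (by linarith) hB
    have e2 : ∀ᶠ n in atTop, ‖x (φ n) - T (x (φ n))‖ < ε / 2 :=
      (hreg.comp hφ.tendsto_atTop).eventually (gt_mem_nhds (half_pos hε))
    refine limsup_le_of_le (isCoboundedUnder_le_of_le atTop (x := 0) fun n => norm_nonneg _) ?_
    filter_upwards [e1, e2] with n h1 h2
    have h3 := norm_add_le (x (φ n) - T (x (φ n))) (T (x (φ n)) - T q)
    rw [sub_add_sub_cancel] at h3
    linarith [hT _ (hxC (φ n)) q hq]
  -- uniqueness of weak subsequential limits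
  have hle : ∀ φ : ℕ → ℕ, StrictMono φ → ∀ q ∈ C, T q = q → ∀ q' ∈ C, T q' = q' →
      (∀ f : E →L[ℝ] ℝ, Tendsto (fun n => f (x (φ n))) atTop (nhds (f q))) → q' ≠ q →
      ∀ c c', Tendsto (fun n => ‖x n - q‖) atTop (nhds c) →
        Tendsto (fun n => ‖x n - q'‖) atTop (nhds c') → c < c' := by
    intro φ hφ q hq hqq q' hq' hqq' hw hne c c' hc hc'
    have := hOpial (fun n => x (φ n)) q hw q' hne
    rwa [(show limsup (fun n => ‖x (φ n) - q‖) atTop = c from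
        (hc.comp hφ.tendsto_atTop).limsup_eq),
      (show limsup (fun n => ‖x (φ n) - q'‖) atTop = c' from
        (hc'.comp hφ.tendsto_atTop).limsup_eq)] at this
  obtain ⟨M, hM⟩ := hbd 0
  simp only [sub_zero] at hM
  obtain ⟨q, φ, hφ, hH, hw⟩ := weak_seq_compact x M hM
  have hq : q ∈ C := hH C hCcl hCcv hxC
  have hqq := hdemi φ hφ q hq hw
  refine ⟨q, hq, hqq, fun f => ?_⟩
  by_contra hcon
  obtain ⟨ε, hε, ψ, hψ, hbad⟩ := bad_subseq _ _ hcon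
  obtain ⟨q', χ, hχ, hH', hw'⟩ := weak_seq_compact (fun n => x (ψ n)) M (fun n => hM _)
  have hq' : q' ∈ C := hH' C hCcl hCcv fun n => hxC _
  have hqq' := hdemi (ψ ∘ χ) (hψ.comp hχ) q' hq' hw'
  have heq : q' = q := by
    by_contra hne
    obtain ⟨c, hc, -⟩ := hlim q hq hqq
    obtain ⟨c', hc', -⟩ := hlim q' hq' hqq'
    have h1 := hle φ hφ q hq hqq q' hq' hqq' hw hne c c' hc hc'
    have h2 := hle (ψ ∘ χ) (hψ.comp hχ) q' hq' hqq' q hq hqq hw' (Ne.symm hne) c' c hc' hc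
    exact lt_asymm h1 h2
  rw [heq] at hw'
  rcases hbad with hbad | hbad
  · have := ge_of_tendsto' (hw' f) fun n => hbad (χ n)
    linarith
  · have := le_of_tendsto' (hw' f) fun n => hbad (χ n)
    linarith
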